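/- For every β ∈ (−3,0) there exists a constant C_β > 0 such that for all v ∈ ℝ³ one has |J_β(v) − ⟨v⟩^β| ≤ C_β ⟨v⟩^{β−1/2}. -/

import Mathlib

noncomputable section

open MeasureTheory Real Filter

abbrev V3 := EuclideanSpace ℝ (Fin 3)

/-- Japanese bracket ⟨v⟩ = (1+|v|²)^{1/2}. -/
def jap (v : V3) : ℝ := Real.sqrt (1 + ‖v‖ ^ 2)

/-- Standard Gaussian μ on ℝ³. -/
def gaussM (v : V3) : ℝ := (2 * Real.pi) ^ (-(3 : ℝ) / 2) * Real.exp (-‖v‖ ^ 2 / 2)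

/-- Landau kernel matrix a_{ij}(z). -/
def aker (γ : ℝ) (z : V3) (i j : Fin 3) : ℝ :=
  ‖z‖ ^ (γ + 2) * ((if i = j then (1 : ℝ) else 0) - z i * z j / ‖z‖ ^ 2)

/-- ā_{ij} = a_{ij} * μ. -/
def abar (γ : ℝ) (v : V3) (i j : Fin 3) : ℝ := ∫ w : V3, aker γ (v - w) i j * gaussM w

def bker (γ : ℝ) (z : V3) (i : Fin 3) : ℝ := -2 * ‖z‖ ^ γ * z i

/-- b̄_i = b_i * μ. -/
def bbar (γ : ℝ) (v : V3) (i : Fin 3) : ℝ := ∫ w : V3, bker γ (v - w) i * gaussM w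

/-- J_β(v) = ∫ |v−w|^β μ(w) dw. -/
def Jfun (β : ℝ) (v : V3) : ℝ := ∫ w : V3, ‖v - w‖ ^ β * gaussM w

/-- c̄(v) = −2(γ+3) J_γ(v). -/
def cbar (γ : ℝ) (v : V3) : ℝ := -2 * (γ + 3) * Jfun γ v

/-- ℓ₁(v). -/
def ell1 (γ : ℝ) (v : V3) : ℝ :=
  ∫ w : V3, (1 - ((∑ i, v i * w i) / (‖v‖ * ‖w‖)) ^ 2) * ‖w‖ ^ (γ + 2) * gaussM (v - w)

/-- Squared Euclidean norm of the cross product of two vectors in ℝ³. -/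
def crossSq (a b : V3) : ℝ :=
  ∑ i, (crossProduct (R := ℝ) (fun k => a k) (fun k => b k) i) ^ 2

/-- ℓ₂(v). -/
def ell2 (γ : ℝ) (v : V3) : ℝ :=
  ∫ w : V3,
    (1 - (1 / 2) * crossSq (‖v‖⁻¹ • v) (‖w‖⁻¹ • w)) * ‖w‖ ^ (γ + 2) * gaussM (v - w)

/-- Projection P_v ξ on the direction v. -/
def Pv (v ξ : V3) : V3 := ((∑ i, ξ i * v i) / ‖v‖ ^ 2) • v

/-- Partial derivative in the i-th coordinate direction. -/
def pd (i : Fin 3) (f : V3 → ℝ) : V3 → ℝ := fun v => fderiv ℝ f v (EuclideanSpace.single i 1)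

/-- Anisotropic gradient ∇̃f = P_v ∇f + ⟨v⟩ (I − P_v) ∇f. -/
def anisoGrad (f : V3 → ℝ) (v : V3) : V3 :=
  Pv v (gradient f v) + jap v • (gradient f v - Pv v (gradient f v))

/-- The filter |v| → ∞ on ℝ³. -/
def normAtTop : Filter V3 := Filter.comap (fun v : V3 => ‖v‖) Filter.atTop

lemma one_le_jap (v : V3) : 1 ≤ jap v :=
  Real.one_le_sqrt.2 (by nlinarith [sq_nonneg ‖v‖])

lemma norm_le_jap (v : V3) : ‖v‖ ≤ jap v :=
  Real.le_sqrt_of_sq_le (by linarith)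

lemma jap_le_one_add_norm (v : V3) : jap v ≤ 1 + ‖v‖ :=
  Real.sqrt_le_iff.2 ⟨by positivity, by nlinarith [norm_nonneg v]⟩

lemma abs_norm_sub_sub_jap_le (v w : V3) : |‖v - w‖ - jap v| ≤ 1 + ‖w‖ := by
  have h₁ := norm_sub_le v w
  have h₂ := norm_sub_norm_le v w
  have h₃ := norm_le_jap v
  have h₄ := jap_le_one_add_norm v
  rw [abs_le]
  constructor <;> linarith

lemma gaussM_nonneg (w : V3) : 0 ≤ gaussM w := by
  unfold gaussM
  positivity

lemma continuous_gaussM : Continuous gaussM := by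
  unfold gaussM
  fun_prop

lemma integral_gaussM : ∫ w : V3, gaussM w = 1 := by
  have h := GaussianFourier.integral_rexp_neg_mul_sq_norm (V := V3) (b := 1 / 2) (by norm_num)
  have e : ∀ w : V3, -‖w‖ ^ 2 / 2 = -(1 / 2) * ‖w‖ ^ 2 := fun w => by ring
  simp only [gaussM, e, integral_const_mul, h, finrank_euclideanSpace, Fintype.card_fin]
  rw [show π / (1 / 2) = 2 * π by ring, ← Real.rpow_add (by positivity)]
  norm_num

/-- The Gaussian decays faster than any power; the eighth power is all that is needed here. -/
lemma exists_gaussM_le :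
    ∃ M > (0 : ℝ), ∀ w : V3, (1 + ‖w‖) ^ 4 * gaussM w ≤ M * (1 + ‖w‖) ^ (-4 : ℝ) := by
  refine ⟨(2 * π) ^ (-(3 : ℝ) / 2) * ((Nat.factorial 8 : ℝ) * Real.exp (3 / 2)), by positivity,
    fun w => ?_⟩
  have hr := norm_nonneg w
  set r := ‖w‖ with hr_def
  have h₁ : (1 + r) ^ 8 ≤ (Nat.factorial 8 : ℝ) * Real.exp (1 + r) := by
    have := Real.pow_div_factorial_le_exp (1 + r) (by positivity) 8
    rwa [div_le_iff₀' (by positivity)] at this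
  have h₂ : Real.exp (1 + r) * Real.exp (-r ^ 2 / 2) ≤ Real.exp (3 / 2) := by
    rw [← Real.exp_add]
    exact Real.exp_le_exp.2 (by nlinarith [sq_nonneg (r - 1)])
  have h₃ : (1 + r) ^ 8 * Real.exp (-r ^ 2 / 2) ≤ (Nat.factorial 8 : ℝ) * Real.exp (3 / 2) :=
    calc _ ≤ (Nat.factorial 8 : ℝ) * Real.exp (1 + r) * Real.exp (-r ^ 2 / 2) := by gcongr
      _ = (Nat.factorial 8 : ℝ) * (Real.exp (1 + r) * Real.exp (-r ^ 2 / 2)) := by ring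
      _ ≤ _ := by gcongr
  have h₄ : (1 + r) ^ (-4 : ℝ) = ((1 + r) ^ 4)⁻¹ := by
    rw [Real.rpow_neg (by positivity)]
    norm_cast
  rw [h₄, ← div_eq_mul_inv, le_div_iff₀ (by positivity), gaussM, ← hr_def]
  calc _ = (2 * π) ^ (-(3 : ℝ) / 2) * ((1 + r) ^ 8 * Real.exp (-r ^ 2 / 2)) := by ring
    _ ≤ _ := by gcongr

/-- The power `|z|^β` cut off to the closed unit ball. -/
def cutPow (β : ℝ) (z : V3) : ℝ := (Set.Iic (1 : ℝ)).indicator (fun r => r ^ β) ‖z‖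

lemma cutPow_nonneg (β : ℝ) (z : V3) : 0 ≤ cutPow β z := by
  refine Set.indicator_apply_nonneg fun _ => ?_
  positivity

lemma norm_rpow_le_one_add_cutPow {β : ℝ} (hβ : β ≤ 0) (z : V3) : ‖z‖ ^ β ≤ 1 + cutPow β z := by
  by_cases h : ‖z‖ ≤ 1
  · simp [cutPow, h]
  · have := Real.rpow_le_one_of_one_le_of_nonpos (not_le.1 h).le hβ
    linarith [cutPow_nonneg β z]

lemma integrable_cutPow {β : ℝ} (hβ : -3 < β) : Integrable (cutPow β) := by
  have h := (integrable_fun_norm_addHaar (volume : Measure V3)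
    (f := (Set.Iic (1 : ℝ)).indicator (fun r => r ^ β))).2
  refine h ?_
  have e : Set.EqOn ((Set.Iic (1 : ℝ)).indicator fun r : ℝ => r ^ (2 + β))
      (fun y => y ^ (Module.finrank ℝ V3 - 1) • (Set.Iic (1 : ℝ)).indicator (fun r => r ^ β) y)
      (Set.Ioi 0) := by
    intro y hy
    by_cases h1 : y ≤ 1
    · simp [h1, Real.rpow_add (Set.mem_Ioi.1 hy)]
    · simp [h1]
  refine IntegrableOn.congr_fun ?_ e measurableSet_Ioi
  rw [IntegrableOn, integrable_indicator_iff measurableSet_Iic, IntegrableOn,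
    Measure.restrict_restrict measurableSet_Iic, Set.Iic_inter_Ioi]
  exact (intervalIntegrable_iff_integrableOn_Ioc_of_le zero_le_one).1
    (intervalIntegral.intervalIntegrable_rpow' (by linarith))

lemma abs_rpow_sub_rpow_le {β x y : ℝ} (hβ : β ∈ Set.Ioo (-3 : ℝ) 0) (hy : 0 < y)
    (hx : y / 2 ≤ x) : |x ^ β - y ^ β| ≤ 48 * y ^ (β - 1) * |x - y| := by
  obtain ⟨h3, h0⟩ := hβ
  have hderiv : ∀ t ∈ Set.Ici (y / 2),
      HasDerivWithinAt (fun t : ℝ => t ^ β) (β * t ^ (β - 1)) (Set.Ici (y / 2)) t :=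
    fun t ht => (Real.hasDerivAt_rpow_const
      (Or.inl (lt_of_lt_of_le (half_pos hy) ht).ne')).hasDerivWithinAt
  have hbound : ∀ t ∈ Set.Ici (y / 2), ‖β * t ^ (β - 1)‖ ≤ 48 * y ^ (β - 1) := by
    intro t ht
    have ht0 : 0 < t := lt_of_lt_of_le (half_pos hy) ht
    have h₁ : t ^ (β - 1) ≤ (y / 2) ^ (β - 1) :=
      Real.rpow_le_rpow_of_nonpos (half_pos hy) ht (by linarith)
    have h₂ : (y / 2) ^ (β - 1) = y ^ (β - 1) * 2 ^ (1 - β) := by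
      rw [Real.div_rpow hy.le zero_le_two, div_eq_mul_inv, ← Real.rpow_neg zero_le_two, neg_sub]
    have h₃ : (2 : ℝ) ^ (1 - β) ≤ 2 ^ (4 : ℝ) :=
      Real.rpow_le_rpow_of_exponent_le one_le_two (by linarith)
    rw [Real.norm_eq_abs, abs_mul, abs_of_neg h0, abs_of_pos (Real.rpow_pos_of_pos ht0 _)]
    calc -β * t ^ (β - 1) ≤ 3 * (y ^ (β - 1) * 2 ^ (4 : ℝ)) := by
          refine mul_le_mul (by linarith) (h₁.trans ?_) (by positivity) (by norm_num)
          rw [h₂]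
          gcongr
      _ = 48 * y ^ (β - 1) := by norm_num; ring
  have := (convex_Ici (y / 2)).norm_image_sub_le_of_norm_hasDerivWithin_le hderiv hbound
    (show y ∈ Set.Ici (y / 2) from half_le_self hy.le) hx
  simpa only [Real.norm_eq_abs] using this

lemma abs_norm_rpow_sub_jap_rpow_le {β : ℝ} (hβ : β ∈ Set.Ioo (-3 : ℝ) 0) (v w : V3) :
    |‖v - w‖ ^ β - jap v ^ β| ≤
      48 * jap v ^ (β - 1) * ((1 + cutPow β (v - w)) * (1 + ‖w‖) ^ 4) := by
  have hy := one_le_jap v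
  have hy0 : 0 < jap v := by linarith
  have hxy := abs_norm_sub_sub_jap_le v w
  have hk := cutPow_nonneg β (v - w)
  have hw : 1 ≤ 1 + ‖w‖ := by linarith [norm_nonneg w]
  rcases le_or_gt (jap v / 2) ‖v - w‖ with h | h
  · calc _ ≤ 48 * jap v ^ (β - 1) * |‖v - w‖ - jap v| := abs_rpow_sub_rpow_le hβ hy0 h
      _ ≤ _ := by
        gcongr
        calc |‖v - w‖ - jap v| ≤ 1 + ‖w‖ := hxy
          _ ≤ (1 + ‖w‖) ^ 4 := le_self_pow₀ hw (by norm_num)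
          _ ≤ _ := le_mul_of_one_le_left (by positivity) (by linarith)
  · have hpow : |‖v - w‖ ^ β - jap v ^ β| ≤ 1 + cutPow β (v - w) := by
      have h₁ := norm_rpow_le_one_add_cutPow hβ.2.le (v - w)
      have h₂ := Real.rpow_le_one_of_one_le_of_nonpos hy hβ.2.le
      have h₃ : 0 ≤ ‖v - w‖ ^ β := by positivity
      have h₄ : 0 ≤ jap v ^ β := by positivity
      rw [abs_le]
      constructor <;> linarith
    have hlow : jap v ≤ 2 * (1 + ‖w‖) := by linarith [(abs_le.1 hxy).1]
    have hone : 1 ≤ 48 * jap v ^ (β - 1) * (1 + ‖w‖) ^ 4 := by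
      have h₁ : jap v ^ (-4 : ℝ) ≤ jap v ^ (β - 1) :=
        Real.rpow_le_rpow_of_exponent_le hy (by linarith [hβ.1])
      have h₂ : jap v ^ (-4 : ℝ) * jap v ^ 4 = 1 := by
        rw [Real.rpow_neg hy0.le]
        norm_cast
        exact inv_mul_cancel₀ (by positivity)
      have h₃ : jap v ^ 4 ≤ 48 * (1 + ‖w‖) ^ 4 :=
        calc jap v ^ 4 ≤ (2 * (1 + ‖w‖)) ^ 4 := by gcongr
          _ = 16 * (1 + ‖w‖) ^ 4 := by ring
          _ ≤ _ := by gcongr; norm_num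
      calc 1 = jap v ^ (-4 : ℝ) * jap v ^ 4 := h₂.symm
        _ ≤ jap v ^ (β - 1) * (48 * (1 + ‖w‖) ^ 4) := by gcongr
        _ = _ := by ring
    calc _ ≤ 1 + cutPow β (v - w) := hpow
      _ ≤ (1 + cutPow β (v - w)) * (48 * jap v ^ (β - 1) * (1 + ‖w‖) ^ 4) :=
        le_mul_of_one_le_right (by linarith) hone
      _ = _ := by ring

/-- A weighted Gaussian is integrable against `1 + |v - ·|^β 1_{|v - ·| ≤ 1}`, uniformly in `v`. -/
lemma exists_integral_cutPow_mul_gaussM_le {β : ℝ} (hβ : -3 < β) :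
    ∃ A > (0 : ℝ), ∀ v : V3,
      Integrable (fun w => (1 + cutPow β (v - w)) * ((1 + ‖w‖) ^ 4 * gaussM w)) ∧
        ∫ w, (1 + cutPow β (v - w)) * ((1 + ‖w‖) ^ 4 * gaussM w) ≤ A := by
  obtain ⟨M, hM, hle⟩ := exists_gaussM_le
  have hint : Integrable (fun w : V3 => (1 + ‖w‖) ^ (-4 : ℝ)) :=
    integrable_one_add_norm (by simp; norm_num)
  have hk := integrable_cutPow hβ
  have hI : 0 ≤ ∫ w : V3, (1 + ‖w‖) ^ (-4 : ℝ) := integral_nonneg fun w => by positivity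
  have hK : 0 ≤ ∫ z, cutPow β z := integral_nonneg (cutPow_nonneg β)
  refine ⟨M * ((∫ w : V3, (1 + ‖w‖) ^ (-4 : ℝ)) + ∫ z, cutPow β z) + 1, by positivity,
    fun v => ?_⟩
  have hkv : Integrable (fun w => cutPow β (v - w)) := hk.comp_sub_left v
  have hdom : Integrable (fun w => M * ((1 + ‖w‖) ^ (-4 : ℝ) + cutPow β (v - w))) :=
    (hint.add hkv).const_mul M
  have hpt : ∀ w, (1 + cutPow β (v - w)) * ((1 + ‖w‖) ^ 4 * gaussM w) ≤
      M * ((1 + ‖w‖) ^ (-4 : ℝ) + cutPow β (v - w)) := by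
    intro w
    have h₁ : (1 + ‖w‖) ^ (-4 : ℝ) ≤ 1 :=
      Real.rpow_le_one_of_one_le_of_nonpos (by linarith [norm_nonneg w]) (by norm_num)
    have h₂ := cutPow_nonneg β (v - w)
    calc _ ≤ (1 + cutPow β (v - w)) * (M * (1 + ‖w‖) ^ (-4 : ℝ)) :=
          mul_le_mul_of_nonneg_left (hle w) (by linarith)
      _ = M * ((1 + ‖w‖) ^ (-4 : ℝ) + cutPow β (v - w) * (1 + ‖w‖) ^ (-4 : ℝ)) := by ring
      _ ≤ _ := by
        gcongr
        exact mul_le_of_le_one_right h₂ h₁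
  have hg : Continuous fun w : V3 => (1 + ‖w‖) ^ 4 * gaussM w :=
    ((continuous_const.add continuous_norm).pow 4).mul continuous_gaussM
  have hF : Integrable (fun w => (1 + cutPow β (v - w)) * ((1 + ‖w‖) ^ 4 * gaussM w)) := by
    refine hdom.mono' ((hkv.aestronglyMeasurable.const_add 1).mul hg.aestronglyMeasurable)
      (ae_of_all _ fun w => ?_)
    have h₁ := gaussM_nonneg w
    have h₂ := cutPow_nonneg β (v - w)
    rw [Real.norm_of_nonneg (by positivity)]
    exact hpt w
  refine ⟨hF, ?_⟩
  calc _ ≤ ∫ w, M * ((1 + ‖w‖) ^ (-4 : ℝ) + cutPow β (v - w)) := integral_mono hF hdom hpt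
    _ = M * ((∫ w : V3, (1 + ‖w‖) ^ (-4 : ℝ)) + ∫ z, cutPow β z) := by
      rw [integral_const_mul, integral_add hint hkv, integral_sub_left_eq_self]
    _ ≤ _ := by linarith

/-- Lemma 2.1 (e): for β ∈ (−3,0), |J_β(v) − ⟨v⟩^β| ≤ C_β ⟨v⟩^{β−1/2} for all v. -/
theorem stmt5 (β : ℝ) (hβ : β ∈ Set.Ioo (-3 : ℝ) 0) :
    ∃ C > (0 : ℝ), ∀ v : V3, |Jfun β v - jap v ^ β| ≤ C * jap v ^ (β - 1 / 2) := by
  obtain ⟨A, hA, hbound⟩ := exists_integral_cutPow_mul_gaussM_le hβ.1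
  refine ⟨48 * A, by positivity, fun v => ?_⟩
  obtain ⟨hF, hFA⟩ := hbound v
  have hy0 : 0 < jap v := zero_lt_one.trans_le (one_le_jap v)
  have hgauss : Integrable gaussM := by
    by_contra h
    simpa [integral_undef h] using integral_gaussM
  have hJ : Integrable (fun w => ‖v - w‖ ^ β * gaussM w) := by
    refine hF.mono' (Measurable.aestronglyMeasurable ?_) (ae_of_all _ fun w => ?_)
    · exact ((measurable_const.sub measurable_id).norm.pow_const β).mul
        continuous_gaussM.measurable
    · have h₁ := gaussM_nonneg w
      have h₂ := cutPow_nonneg β (v - w)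
      rw [Real.norm_of_nonneg (by positivity)]
      gcongr
      · exact norm_rpow_le_one_add_cutPow hβ.2.le _
      · exact le_mul_of_one_le_left h₁ (one_le_pow₀ (by linarith [norm_nonneg w]))
  have heq : Jfun β v - jap v ^ β = ∫ w, (‖v - w‖ ^ β - jap v ^ β) * gaussM w := by
    simp only [sub_mul]
    rw [integral_sub hJ (hgauss.const_mul _), integral_const_mul, integral_gaussM, mul_one, Jfun]
  rw [heq, ← Real.norm_eq_abs]
  calc _ ≤ ∫ w, 48 * jap v ^ (β - 1) *
        ((1 + cutPow β (v - w)) * ((1 + ‖w‖) ^ 4 * gaussM w)) := by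
        refine norm_integral_le_of_norm_le (hF.const_mul _) (ae_of_all _ fun w => ?_)
        rw [norm_mul, Real.norm_of_nonneg (gaussM_nonneg w), Real.norm_eq_abs]
        refine (mul_le_mul_of_nonneg_right (abs_norm_rpow_sub_jap_rpow_le hβ v w)
          (gaussM_nonneg w)).trans_eq ?_
        ring
    _ ≤ 48 * jap v ^ (β - 1 / 2) * A := by
        rw [integral_const_mul]
        have h := Real.rpow_le_rpow_of_exponent_le (one_le_jap v)
          (show β - 1 ≤ β - 1 / 2 by linarith)
        exact (mul_le_mul_of_nonneg_left hFA (by positivity)).trans (by gcongr)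
    _ = _ := by ring
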